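/- arXiv:1003.5882 — 3 statements merged into one kernel-verified Lean document; each statement's English description precedes it below -/
import Mathlib

section
/- (q-Leibniz formula, Prop. 2.2(3), second form) Let a, b ∈ A, q_ab, q_aa ∈ k, and define iterated q-commutators by d_0 := b and d_{k+1} := a * d_k − (q_aa^k * q_ab) • (d_k * a). Then for every integer r ≥ 1: a^r * b − q_ab^r • (b * a^r) = Σ_{i=0}^{r−1} q_ab^i • binom(r,i)_{q_aa} • (d_{r−i} * a^i). -/
/-- Gaussian binomial coefficient `binom(n,i)_q`, defined by `binom(n,0)_q = 1`,
`binom(0,i)_q = 0` for `i ≥ 1`, and the q-Pascal rule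
`binom(n+1,i)_q = q^i * binom(n,i)_q + binom(n,i-1)_q`. -/
def qBinom {k : Type*} [Field k] (q : k) : ℕ → ℕ → k
  | _, 0 => 1
  | 0, _ + 1 => 0
  | n + 1, i + 1 => q ^ (i + 1) * qBinom q n (i + 1) + qBinom q n i

theorem qBinom_eq_zero {k : Type*} [Field k] (q : k) :
    ∀ n i : ℕ, n < i → qBinom q n i = 0 := by
  intro n
  induction n with
  | zero =>
    intro i h
    obtain ⟨j, rfl⟩ : ∃ j, i = j + 1 := ⟨i - 1, by omega⟩
    simp [qBinom]
  | succ n ih =>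
    intro i h
    obtain ⟨j, rfl⟩ : ∃ j, i = j + 1 := ⟨i - 1, by omega⟩
    simp [qBinom, ih (j + 1) (by omega), ih j (by omega)]

theorem qBinom_zero_right {k : Type*} [Field k] (q : k) (n : ℕ) : qBinom q n 0 = 1 := by
  cases n <;> simp [qBinom]

theorem qBinom_self {k : Type*} [Field k] (q : k) (n : ℕ) : qBinom q n n = 1 := by
  induction n with
  | zero => simp [qBinom]
  | succ n ih => simp [qBinom, ih, qBinom_eq_zero q n (n + 1) (by omega)]

theorem qLeibniz_aux {k A : Type*} [Field k] [Ring A] [Algebra k A]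
    (a : A) (qab qaa : k) (d : ℕ → A)
    (hd : ∀ n : ℕ, d (n + 1) = a * d n - (qaa ^ n * qab) • (d n * a)) (r : ℕ) :
    ∀ m : ℕ, a ^ r * d m = ∑ i ∈ Finset.range (r + 1),
      (qab ^ i * qaa ^ (m * i) * qBinom qaa r i) • (d (m + (r - i)) * a ^ i) := by
  induction r with
  | zero => intro m; simp [qBinom]
  | succ r ih =>
    intro m
    have h1 : a ^ (r + 1) * d m
        = a ^ r * d (m + 1) + (qaa ^ m * qab) • (a ^ r * d m * a) := by
      rw [hd m, mul_sub, mul_smul_comm, pow_succ]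
      simp [mul_assoc]
    have h2 : a ^ r * d (m + 1) = ∑ i ∈ Finset.range (r + 1 + 1),
        (qab ^ i * qaa ^ ((m + 1) * i) * qBinom qaa r i) • (d (m + 1 + (r - i)) * a ^ i) := by
      rw [Finset.sum_range_succ, qBinom_eq_zero qaa r (r + 1) (by omega), ih (m + 1)]
      simp
    rw [h1, h2, ih m, Finset.sum_range_succ', Finset.sum_range_succ' _ (r + 1),
      Finset.sum_mul, Finset.smul_sum, add_right_comm, ← Finset.sum_add_distrib]
    congr 1
    · apply Finset.sum_congr rfl
      intro j hj
      have hj' : j < r + 1 := Finset.mem_range.mp hj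
      rw [show r + 1 - (j + 1) = r - j by omega, smul_mul_assoc, smul_smul, mul_assoc (d _),
        ← pow_succ]
      rcases Nat.lt_or_ge j r with h | h
      · rw [show m + 1 + (r - (j + 1)) = m + (r - j) by omega, ← add_smul]
        congr 1
        simp only [qBinom]
        ring
      · rw [qBinom_eq_zero qaa r (j + 1) (by omega)]
        simp only [qBinom, qBinom_eq_zero qaa r (j + 1) (by omega), mul_zero, zero_smul, zero_add]
        congr 1
        ring
    · simp only [qBinom_zero_right]
      simp [show m + 1 + r = m + (r + 1) by omega]

/-- q-Leibniz formula, second form: `[a^r, b]` expanded via iterated q-commutators. -/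
theorem qLeibniz_second {k A : Type*} [Field k] [Ring A] [Algebra k A]
    (a b : A) (qab qaa : k) (d : ℕ → A)
    (hd0 : d 0 = b)
    (hd : ∀ n : ℕ, d (n + 1) = a * d n - (qaa ^ n * qab) • (d n * a))
    (r : ℕ) (hr : 1 ≤ r) :
    a ^ r * b - (qab ^ r) • (b * a ^ r)
      = ∑ i ∈ Finset.range r, (qab ^ i * qBinom qaa r i) • (d (r - i) * a ^ i) := by
  have h := qLeibniz_aux a qab qaa d hd r 0
  rw [Finset.sum_range_succ, qBinom_self] at h
  simp only [hd0, zero_mul, pow_zero, mul_one, Nat.sub_self, Nat.zero_add] at h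
  rw [h, add_sub_cancel_right]
end

section
/- (restricted q-Leibniz formula, Prop. 2.2(4), second form) Assume char k = 0. Let a, b ∈ A, q_ab, q_aa ∈ k, and define d_0 := b and d_{k+1} := a * d_k − (q_aa^k * q_ab) • (d_k * a). If q_aa has multiplicative order exactly r (i.e. q_aa^r = 1 and q_aa^m ≠ 1 for all 1 ≤ m < r), then a^r * b − q_ab^r • (b * a^r) = d_r. -/
/-- Gaussian binomial coefficients. -/
def gaussBin {k : Type*} [Field k] (q : k) : ℕ → ℕ → k
  | _, 0 => 1
  | 0, _ + 1 => 0
  | n + 1, i + 1 => gaussBin q n i + q ^ (i + 1) * gaussBin q n (i + 1)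

theorem gaussBin_zero_right {k : Type*} [Field k] (q : k) (n : ℕ) : gaussBin q n 0 = 1 := by
  cases n <;> simp [gaussBin]

theorem gaussBin_succ {k : Type*} [Field k] (q : k) (n i : ℕ) :
    gaussBin q (n + 1) (i + 1) = gaussBin q n i + q ^ (i + 1) * gaussBin q n (i + 1) := by
  simp [gaussBin]

theorem gaussBin_of_lt {k : Type*} [Field k] (q : k) (n : ℕ) :
    ∀ i, n < i → gaussBin q n i = 0 := by
  induction n with
  | zero => intro i hi; cases i with
    | zero => omega
    | succ i => simp [gaussBin]
  | succ n ih => intro i hi; cases i with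
    | zero => omega
    | succ i => rw [gaussBin_succ, ih i (by omega), ih (i + 1) (by omega)]; simp

theorem gaussBin_self {k : Type*} [Field k] (q : k) (n : ℕ) : gaussBin q n n = 1 := by
  induction n with
  | zero => simp [gaussBin]
  | succ n ih => rw [gaussBin_succ, ih, gaussBin_of_lt q n (n + 1) (by omega)]; simp

theorem gaussBin_absorb {k : Type*} [Field k] (q : k) (n : ℕ) :
    ∀ i, (q ^ (i + 1) - 1) * gaussBin q (n + 1) (i + 1) = (q ^ (n + 1) - 1) * gaussBin q n i := by
  induction n with
  | zero => intro i; cases i with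
    | zero => simp [gaussBin]
    | succ i => simp [gaussBin]
  | succ m ih =>
    intro i
    have h1 := ih i
    rw [gaussBin_succ q (m + 1) i]
    cases i with
    | zero =>
      rw [gaussBin_zero_right] at *
      linear_combination q ^ (0 + 1) * h1
    | succ j =>
      have h2 := ih j
      have h3 := gaussBin_succ q m j
      linear_combination q ^ (j + 2) * h1 + q * h2 - q * (q ^ (m + 1) - 1) * h3

theorem qLeibniz_expand {k A : Type*} [Field k] [Ring A] [Algebra k A]
    (a b : A) (qab qaa : k) (d : ℕ → A) (hd0 : d 0 = b)
    (hd : ∀ n : ℕ, d (n + 1) = a * d n - (qaa ^ n * qab) • (d n * a)) (n : ℕ) :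
    a ^ n * b = ∑ i ∈ Finset.range (n + 1),
      (gaussBin qaa n i * qab ^ (n - i)) • (d i * a ^ (n - i)) := by
  induction n with
  | zero => simp [gaussBin, hd0]
  | succ n ih =>
    have key : ∀ i ∈ Finset.range (n + 1),
        a * ((gaussBin qaa n i * qab ^ (n - i)) • (d i * a ^ (n - i))) =
        (gaussBin qaa n i * qab ^ (n - i)) • (d (i + 1) * a ^ (n - i)) +
        (qaa ^ i * gaussBin qaa n i * qab ^ (n + 1 - i)) • (d i * a ^ (n + 1 - i)) := by
      intro i hi
      have hi' : n + 1 - i = (n - i) + 1 := by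
        have := Finset.mem_range.mp hi
        omega
      have h : a * d i = d (i + 1) + (qaa ^ i * qab) • (d i * a) := by rw [hd]; abel
      rw [mul_smul_comm, ← mul_assoc, h, add_mul, smul_add, smul_mul_assoc, smul_smul, hi',
        pow_succ' a, mul_assoc (d i)]
      congr 2
      ring
    rw [pow_succ', mul_assoc, ih, Finset.mul_sum, Finset.sum_congr rfl key,
      Finset.sum_add_distrib, Finset.sum_range_succ' _ (n + 1)]
    have e : ∑ i ∈ Finset.range (n + 1),
        (qaa ^ i * gaussBin qaa n i * qab ^ (n + 1 - i)) • (d i * a ^ (n + 1 - i)) =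
        ∑ i ∈ Finset.range (n + 1), (qaa ^ (i + 1) * gaussBin qaa n (i + 1) *
          qab ^ (n + 1 - (i + 1))) • (d (i + 1) * a ^ (n + 1 - (i + 1))) +
        (qaa ^ 0 * gaussBin qaa n 0 * qab ^ (n + 1 - 0)) • (d 0 * a ^ (n + 1 - 0)) := by
      rw [← Finset.sum_range_succ' (fun i => (qaa ^ i * gaussBin qaa n i * qab ^ (n + 1 - i)) •
        (d i * a ^ (n + 1 - i))) (n + 1), Finset.sum_range_succ _ (n + 1),
        gaussBin_of_lt qaa n (n + 1) (by omega)]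
      simp
    rw [e, ← add_assoc, ← Finset.sum_add_distrib]
    congr 1
    · refine Finset.sum_congr rfl fun i _ => ?_
      rw [gaussBin_succ, Nat.add_sub_add_right, ← add_smul]
      congr 1
      ring
    · simp [gaussBin_zero_right]


/-- Restricted q-Leibniz formula, second form: if `q_aa` has multiplicative order
exactly `r`, then `[a^r, b] = [a,..[a,[a,b]]..]` (`r`-fold iterated q-commutator). -/
theorem restricted_qLeibniz_second {k A : Type*} [Field k] [CharZero k]
    [Ring A] [Algebra k A]
    (a b : A) (qab qaa : k) (d : ℕ → A)
    (hd0 : d 0 = b)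
    (hd : ∀ n : ℕ, d (n + 1) = a * d n - (qaa ^ n * qab) • (d n * a))
    (r : ℕ) (hr : 1 ≤ r)
    (hord : qaa ^ r = 1) (hmin : ∀ m : ℕ, 1 ≤ m → m < r → qaa ^ m ≠ 1) :
    a ^ r * b - (qab ^ r) • (b * a ^ r) = d r := by
  obtain ⟨n, rfl⟩ : ∃ n, r = n + 1 := ⟨r - 1, by omega⟩
  rw [qLeibniz_expand a b qab qaa d hd0 hd, Finset.sum_range_succ, Finset.sum_range_succ',
    Finset.sum_eq_zero, gaussBin_self, gaussBin_zero_right, hd0]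
  · simp
  · intro i hi
    have hi' := Finset.mem_range.mp hi
    have h := gaussBin_absorb qaa n i
    rw [hord, sub_self, zero_mul] at h
    have h0 := (mul_eq_zero.mp h).resolve_left
      (sub_ne_zero.mpr (hmin (i + 1) (by omega) (by omega)))
    rw [h0]
    simp
end

section
/- (Lemma 4.1(3)) Suppose q22^{r−1} * q12 * q21 = 1 for some integer r ≥ 1 and q22^m ≠ 1 for all 1 ≤ m ≤ r−1 (i.e. r ≤ ord q22). Define v_0 := x1 and v_{k+1} := v_k * x2 − (q12 * q22^k) • (x2 * v_k). Then v_r is (1, g1 * g2^r)-skew-primitive: Δ(v_r) = v_r ⊗ 1 + (g1 * g2^r) ⊗ v_r. -/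
open TensorProduct

/-- Gaussian binomial `(a+b choose a)_q`. -/
def serreH {k : Type*} [Field k] (q : k) : ℕ → ℕ → k
  | 0, _ => 1
  | _ + 1, 0 => 1
  | a + 1, b + 1 => serreH q a (b + 1) + q ^ (a + 1) * serreH q (a + 1) b

theorem serreH_zero_left {k : Type*} [Field k] (q : k) (b : ℕ) : serreH q 0 b = 1 := by
  simp [serreH]

theorem serreH_zero_right {k : Type*} [Field k] (q : k) (a : ℕ) : serreH q a 0 = 1 := by
  cases a <;> simp [serreH]

theorem serreH_succ {k : Type*} [Field k] (q : k) (a b : ℕ) :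
    serreH q (a + 1) (b + 1) = serreH q a (b + 1) + q ^ (a + 1) * serreH q (a + 1) b := by
  rw [serreH]

theorem serreH_succ' {k : Type*} [Field k] (q : k) (n : ℕ) : ∀ a b : ℕ, a + b = n →
    serreH q (a + 1) (b + 1) = q ^ (b + 1) * serreH q a (b + 1) + serreH q (a + 1) b := by
  induction n with
  | zero =>
    intro a b h
    obtain ⟨rfl, rfl⟩ : a = 0 ∧ b = 0 := by omega
    simp [serreH]; ring
  | succ n ih =>
    intro a b h
    rw [serreH_succ]
    rcases a with _ | a
    · rcases b with _ | b
      · omega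
      · have h1 := ih 0 b (by omega)
        have h2 := serreH_succ q 0 b
        simp only [serreH_zero_left, zero_add] at *
        linear_combination q * h1 - h2
    · rcases b with _ | b
      · have h1 := ih a 0 (by omega)
        have h2 := serreH_succ q a 0
        simp only [serreH_zero_right, zero_add] at *
        linear_combination h1 - q * h2
      · have h1 := ih a (b + 1) (by omega)
        have h2 := ih (a + 1) b (by omega)
        have h3 := serreH_succ q a (b + 1)
        have h4 := serreH_succ q (a + 1) b
        linear_combination h1 + q ^ (a + 2) * h2 - q ^ (b + 2) * h3 - h4

/-- The coefficients of the coproduct. -/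
def serreC {k : Type*} [Field k] (q p : k) (a b : ℕ) : k :=
  serreH q a b * ∏ s ∈ Finset.range b, (1 - p * q ^ (a + s))

theorem serreC_zero_right {k : Type*} [Field k] (q p : k) (a : ℕ) : serreC q p a 0 = 1 := by
  simp [serreC, serreH_zero_right]

theorem serreC_zero_succ {k : Type*} [Field k] (q p : k) (b : ℕ) :
    serreC q p 0 (b + 1) = (1 - p * q ^ b) * serreC q p 0 b := by
  simp [serreC, serreH_zero_left, Finset.prod_range_succ]; ring

theorem serreC_succ {k : Type*} [Field k] (q p : k) (a b : ℕ) :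
    serreC q p (a + 1) (b + 1) = q ^ (b + 1) * serreC q p a (b + 1)
      + (1 - p * q ^ (2 * (a + 1) + b)) * serreC q p (a + 1) b := by
  have h1 := serreH_succ q a b
  have h2 := serreH_succ' q _ a b rfl
  have e1 : ∏ s ∈ Finset.range (b + 1), (1 - p * q ^ (a + s))
      = (∏ s ∈ Finset.range b, (1 - p * q ^ (a + 1 + s))) * (1 - p * q ^ a) := by
    rw [Finset.prod_range_succ']
    congr 1
    refine Finset.prod_congr rfl fun s _ => ?_
    rw [show a + (s + 1) = a + 1 + s by omega]
  unfold serreC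
  rw [e1, Finset.prod_range_succ]
  generalize ∏ s ∈ Finset.range b, (1 - p * q ^ (a + 1 + s)) = P
  linear_combination P * h2 - P * p * q ^ (a + 1 + b) * h1

theorem serreC_vanish {k : Type*} [Field k] (q p : k) (a b : ℕ)
    (h : q ^ (a + b) * p = 1) : serreC q p a (b + 1) = 0 := by
  unfold serreC
  rw [Finset.prod_range_succ, mul_comm p, h]; simp

theorem serre_sum {k M : Type*} [Field k] [AddCommGroup M] [Module k M] (q p : k)
    (T : ℕ → ℕ → M) (n : ℕ) :
    ∑ x ∈ Finset.HasAntidiagonal.antidiagonal n, serreC q p x.1 x.2 •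
      (q ^ x.2 • T (x.1 + 1) x.2 + (1 - p * q ^ (2 * x.1 + x.2)) • T x.1 (x.2 + 1))
    = ∑ x ∈ Finset.HasAntidiagonal.antidiagonal (n + 1), serreC q p x.1 x.2 • T x.1 x.2 := by
  let L : ℕ → ℕ → k := fun a b => match a with
    | 0 => 0
    | a + 1 => q ^ b * serreC q p a b
  let R : ℕ → ℕ → k := fun a b => match b with
    | 0 => 0
    | b + 1 => (1 - p * q ^ (2 * a + b)) * serreC q p a b
  have key : ∀ x ∈ Finset.HasAntidiagonal.antidiagonal (n + 1),
      serreC q p x.1 x.2 • T x.1 x.2 = L x.1 x.2 • T x.1 x.2 + R x.1 x.2 • T x.1 x.2 := by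
    rintro ⟨a, b⟩ hx
    rw [Finset.HasAntidiagonal.mem_antidiagonal] at hx
    rw [← add_smul]
    congr 1
    rcases a with _ | a <;> rcases b with _ | b
    · simp at hx
    · simp [L, R, serreC_zero_succ]
    · simp [L, R, serreC_zero_right]
    · simp only [L, R, serreC_succ]
  rw [Finset.sum_congr rfl key, Finset.sum_add_distrib, Finset.Nat.sum_antidiagonal_succ,
    Finset.Nat.sum_antidiagonal_succ']
  simp only [L, R, zero_smul, zero_add, add_zero]
  rw [← Finset.sum_add_distrib]
  refine Finset.sum_congr rfl fun x _ => ?_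
  simp only [smul_add, smul_smul]
  congr 2 <;> ring

/-- Lemma 4.1(3): if `q22^(r-1) * q12 * q21 = 1` and `r ≤ ord q22`, then the iterated
q-commutator `[x1 x2^r]` is `(1, g1 * g2^r)`-skew-primitive. -/
theorem serre_skew_primitive_right
    {k A : Type*} [Field k] [CharZero k] [Ring A] [Bialgebra k A]
    (g1 g2 x1 x2 : A) (q11 q12 q21 q22 : k)
    (hg1 : Coalgebra.comul (R := k) g1 = g1 ⊗ₜ[k] g1)
    (hg2 : Coalgebra.comul (R := k) g2 = g2 ⊗ₜ[k] g2)
    (hεg1 : Coalgebra.counit (R := k) g1 = 1)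
    (hεg2 : Coalgebra.counit (R := k) g2 = 1)
    (hcomm : g1 * g2 = g2 * g1)
    (hx1 : Coalgebra.comul (R := k) x1 = x1 ⊗ₜ[k] (1 : A) + g1 ⊗ₜ[k] x1)
    (hx2 : Coalgebra.comul (R := k) x2 = x2 ⊗ₜ[k] (1 : A) + g2 ⊗ₜ[k] x2)
    (hq11 : q11 ≠ 0) (hq12 : q12 ≠ 0) (hq21 : q21 ≠ 0) (hq22 : q22 ≠ 0)
    (h11 : g1 * x1 = q11 • (x1 * g1)) (h12 : g1 * x2 = q12 • (x2 * g1))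
    (h21 : g2 * x1 = q21 • (x1 * g2)) (h22 : g2 * x2 = q22 • (x2 * g2))
    (r : ℕ) (hr : 1 ≤ r)
    (hq : q22 ^ (r - 1) * q12 * q21 = 1)
    (hordr : ∀ m : ℕ, 1 ≤ m → m ≤ r - 1 → q22 ^ m ≠ 1)
    (v : ℕ → A) (hv0 : v 0 = x1)
    (hv : ∀ n : ℕ, v (n + 1) = v n * x2 - (q12 * q22 ^ n) • (x2 * v n)) :
    Coalgebra.comul (R := k) (v r) = (v r) ⊗ₜ[k] (1 : A) + (g1 * g2 ^ r) ⊗ₜ[k] (v r) := by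
  have hgx : ∀ b : ℕ, g2 ^ b * x2 = q22 ^ b • (x2 * g2 ^ b) := by
    intro b
    induction b with
    | zero => simp
    | succ b ih =>
      rw [pow_succ, mul_assoc, h22, mul_smul_comm, ← mul_assoc, ih, smul_mul_assoc, smul_smul,
        mul_assoc, pow_succ, mul_comm q22]
  have hgv : ∀ a : ℕ, g2 * v a = (q21 * q22 ^ a) • (v a * g2) := by
    intro a
    induction a with
    | zero => simp [hv0, h21]
    | succ a ih =>
      have e1 : g2 * (v a * x2) = (q21 * q22 ^ (a + 1)) • (v a * x2 * g2) := by
        rw [← mul_assoc, ih, smul_mul_assoc, mul_assoc, h22, mul_smul_comm, smul_smul,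
          mul_assoc (v a)]
        congr 1; ring
      have e2 : g2 * (x2 * v a) = (q21 * q22 ^ (a + 1)) • (x2 * v a * g2) := by
        rw [← mul_assoc, h22, smul_mul_assoc, mul_assoc, ih, mul_smul_comm, smul_smul,
          mul_assoc x2]
        congr 1; ring
      rw [hv, mul_sub, mul_smul_comm, e1, e2, sub_mul, smul_mul_assoc, smul_sub, smul_comm]
  have hcp : ∀ n : ℕ, g2 * (g1 * g2 ^ n) = g1 * g2 ^ (n + 1) := by
    intro n
    rw [← mul_assoc, ← hcomm, mul_assoc, ← pow_succ']
  let T : ℕ → ℕ → A ⊗[k] A := fun a b => (v a * g2 ^ b) ⊗ₜ[k] (x2 ^ b)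
  have hT : ∀ a b : ℕ, T a b * (x2 ⊗ₜ[k] (1 : A) + g2 ⊗ₜ[k] x2)
      - (q12 * q22 ^ (a + b)) • ((x2 ⊗ₜ[k] (1 : A) + g2 ⊗ₜ[k] x2) * T a b)
      = q22 ^ b • T (a + 1) b + (1 - q12 * q21 * q22 ^ (2 * a + b)) • T a (b + 1) := by
    intro a b
    have e1 : v a * g2 ^ b * x2 = q22 ^ b • (v a * x2 * g2 ^ b) := by
      rw [mul_assoc, hgx, mul_smul_comm, mul_assoc]
    have e2 : g2 * (v a * g2 ^ b) = (q21 * q22 ^ a) • (v a * g2 ^ (b + 1)) := by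
      rw [← mul_assoc, hgv, smul_mul_assoc, mul_assoc, ← pow_succ']
    simp only [T, mul_add, add_mul, Algebra.TensorProduct.tmul_mul_tmul, mul_one, one_mul, e1, e2,
      hv, sub_mul, smul_mul_assoc, TensorProduct.sub_tmul, ← TensorProduct.smul_tmul',
      mul_assoc (v a) (g2 ^ b) g2, ← pow_succ, ← pow_succ', mul_assoc x2 (v a)]
    module
  have hG : ∀ n : ℕ, (g1 * g2 ^ n) ⊗ₜ[k] (v n) * (x2 ⊗ₜ[k] (1 : A) + g2 ⊗ₜ[k] x2)
      - (q12 * q22 ^ n) • ((x2 ⊗ₜ[k] (1 : A) + g2 ⊗ₜ[k] x2) * (g1 * g2 ^ n) ⊗ₜ[k] (v n))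
      = (g1 * g2 ^ (n + 1)) ⊗ₜ[k] (v (n + 1)) := by
    intro n
    have e1 : g1 * g2 ^ n * x2 = (q12 * q22 ^ n) • (x2 * (g1 * g2 ^ n)) := by
      rw [mul_assoc, hgx, mul_smul_comm, ← mul_assoc, h12, smul_mul_assoc, smul_smul, mul_assoc,
        mul_comm q12]
    simp only [mul_add, add_mul, Algebra.TensorProduct.tmul_mul_tmul, mul_one, one_mul, e1, hcp,
      hv, TensorProduct.tmul_sub, TensorProduct.tmul_smul, ← TensorProduct.smul_tmul',
      mul_assoc g1 (g2 ^ n) g2, ← pow_succ]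
    module
  have main : ∀ n : ℕ, Coalgebra.comul (R := k) (v n) = (g1 * g2 ^ n) ⊗ₜ[k] (v n)
      + ∑ x ∈ Finset.HasAntidiagonal.antidiagonal n, serreC q22 (q12 * q21) x.1 x.2 • T x.1 x.2 := by
    intro n
    induction n with
    | zero => simp [hv0, hx1, T, serreC_zero_right, add_comm]
    | succ n ih =>
      rw [← serre_sum, ← hG, hv, map_sub, map_smul, Bialgebra.comul_mul, Bialgebra.comul_mul, ih,
        hx2]
      generalize hD : x2 ⊗ₜ[k] (1 : A) + g2 ⊗ₜ[k] x2 = D at *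
      have hs : ∑ x ∈ Finset.HasAntidiagonal.antidiagonal n, serreC q22 (q12 * q21) x.1 x.2 •
          (q22 ^ x.2 • T (x.1 + 1) x.2
            + (1 - q12 * q21 * q22 ^ (2 * x.1 + x.2)) • T x.1 (x.2 + 1))
          = (∑ x ∈ Finset.HasAntidiagonal.antidiagonal n, serreC q22 (q12 * q21) x.1 x.2 • T x.1 x.2) * D
          - (q12 * q22 ^ n) •
            (D * ∑ x ∈ Finset.HasAntidiagonal.antidiagonal n, serreC q22 (q12 * q21) x.1 x.2 • T x.1 x.2) := by
        rw [Finset.sum_mul, Finset.mul_sum, Finset.smul_sum, ← Finset.sum_sub_distrib]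
        refine Finset.sum_congr rfl fun x hx => ?_
        rw [Finset.HasAntidiagonal.mem_antidiagonal] at hx
        rw [← hT, hx, smul_mul_assoc, mul_smul_comm, smul_sub, smul_comm (q12 * q22 ^ n)]
      rw [hs, add_mul, mul_add, smul_add]
      abel
  obtain ⟨m, rfl⟩ : ∃ m, r = m + 1 := ⟨r - 1, by omega⟩
  rw [main, Finset.Nat.sum_antidiagonal_succ', Finset.sum_eq_zero, add_comm]
  · simp [T, serreC_zero_right]
  · rintro ⟨a, b⟩ hx
    rw [Finset.HasAntidiagonal.mem_antidiagonal] at hx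
    dsimp only at hx ⊢
    rw [serreC_vanish, zero_smul]
    rw [hx, ← mul_assoc]
    simpa using hq
end
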